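/- Let p ≥ 2, let G be a finite group generated by distinguished elements t_0, …, t_{p−1}, and let K be a subgroup of G. Let a be the sequence with values in the set G/K of left cosets given by a_n = (t_{d_0} t_{d_1} ⋯ t_{d_k}) K, where d_k ⋯ d_0 are the base-p digits of n (d_0 least significant). Then a is p-automatic and self-similar, each map t_i : N(a) → N(a) is a bijection, and the group G(a) of permutations of N(a) generated by the t_i acts freely on N(a) (so Γ(a) is the Cayley graph of G(a)). If moreover the intersection of all conjugates g K g^{−1} (g ∈ G) is trivial, then there is a bijection β : G → N(a) with β(1) = a and β(g t_i) = t_i(β(g)) for all g ∈ G and 0 ≤ i < p, and the induced map G → G(a) carrying each generator t_i of G to the map t_i on N(a) is a group isomorphism. -/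

import Mathlib

open scoped Classical

/-- `a k` encodes the term of index `k + 1` of a sequence `(a_n)_{n ≥ 1}` indexed from `1`.
`subSeq p a i j` encodes the subsequence `a^{(i,j)}` defined by `a^{(i,j)}_n = a_{p^i n + j}`
for `n ≥ 1`. -/
def subSeq (p : ℕ) {Δ : Type*} (a : ℕ → Δ) (i j : ℕ) : ℕ → Δ :=
  fun k => a (p ^ i * (k + 1) + j - 1)

/-- `N(a)`: the set of all subsequences `a^{(i,j)}` with `0 ≤ j < p^i`. -/
def NSet (p : ℕ) {Δ : Type*} (a : ℕ → Δ) : Set (ℕ → Δ) :=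
  {u | ∃ i j : ℕ, j < p ^ i ∧ u = subSeq p a i j}

/-- `a` is `p`-automatic iff `N(a)` is finite. -/
def IsAutomatic (p : ℕ) {Δ : Type*} (a : ℕ → Δ) : Prop :=
  (NSet p a).Finite

/-- `a` is self-similar if `a` is equivalent to every `u ∈ N(a)`: each `u ∈ N(a)` is obtained
from `a` by a bijection of the alphabet. -/
def SelfSimilar (p : ℕ) {Δ : Type*} (a : ℕ → Δ) : Prop :=
  ∀ u ∈ NSet p a, ∃ φ : Δ ≃ Δ, ∀ k, u k = φ (a k)

theorem aux_foldl {G : Type*} [Group G] (t : ℕ → G) (l : List ℕ) (s : G) :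
    l.foldl (fun g d => g * t d) s = s * (l.map t).prod := by
  induction l generalizing s with
  | nil => simp
  | cons d l ih => simp [ih, mul_assoc]

theorem aux_digits {p : ℕ} (hp : 2 ≤ p) (n i : ℕ) (hi : i < p) (hn : 0 < n) :
    Nat.digits p (p * n + i) = i :: Nat.digits p n := by
  rw [add_comm]
  exact Nat.digits_add p (by omega) i n hi (Or.inr (by omega))

theorem aux_sub_succ {p : ℕ} (hp : 2 ≤ p) {Δ : Type*} (u : ℕ → Δ) (i j d : ℕ) :
    subSeq p u (i + 1) (p * j + d) = subSeq p (subSeq p u 1 d) i j := by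
  funext k
  simp only [subSeq]
  congr 1
  have h1 : 0 < p ^ i * (k + 1) := Nat.mul_pos (Nat.pow_pos (by omega)) (by omega)
  have h2 : p ^ i * (k + 1) + j - 1 + 1 = p ^ i * (k + 1) + j := by omega
  rw [h2]
  congr 1
  ring

theorem aux_word {p : ℕ} (hp : 2 ≤ p) {Δ : Type*} (w : List ℕ) (hw : ∀ d ∈ w, d < p) :
    ∃ i j, j < p ^ i ∧ ∀ u : ℕ → Δ, w.foldl (fun v d => subSeq p v 1 d) u = subSeq p u i j := by
  induction w with
  | nil => exact ⟨0, 0, by simp, fun u => by funext k; simp [subSeq]⟩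
  | cons d w ih =>
    obtain ⟨i, j, hj, h⟩ := ih (fun e he => hw e (List.mem_cons_of_mem _ he))
    have hd : d < p := hw d (by simp)
    refine ⟨i + 1, p * j + d, ?_, fun u => ?_⟩
    · rw [pow_succ]
      nlinarith
    · rw [List.foldl_cons, h, aux_sub_succ hp]

theorem aux_word' {p : ℕ} (hp : 2 ≤ p) {Δ : Type*} (i : ℕ) : ∀ (j : ℕ), j < p ^ i →
    ∃ w : List ℕ, (∀ d ∈ w, d < p) ∧
      ∀ u : ℕ → Δ, w.foldl (fun v d => subSeq p v 1 d) u = subSeq p u i j := by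
  induction i with
  | zero =>
    intro j hj
    have : j = 0 := by simpa using hj
    subst this
    exact ⟨[], by simp, fun u => by funext k; simp [subSeq]⟩
  | succ i ih =>
    intro j hj
    obtain ⟨w, hw, h⟩ := ih (j / p) (by
      apply Nat.div_lt_of_lt_mul
      rwa [pow_succ, mul_comm] at hj)
    refine ⟨j % p :: w, ?_, fun u => ?_⟩
    · intro d hd
      rcases List.mem_cons.1 hd with rfl | hd
      · exact Nat.mod_lt _ (by omega)
      · exact hw d hd
    · rw [List.foldl_cons, h, ← aux_sub_succ hp, Nat.div_add_mod]

theorem aux_gen {p : ℕ} {G : Type*} [Group G] [Finite G]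
    (t : ℕ → G) (hgen : Subgroup.closure (t '' Set.Iio p) = ⊤) (g : G) :
    ∃ w : List ℕ, (∀ d ∈ w, d < p) ∧ (w.map t).prod = g := by
  have hg : g ∈ Submonoid.closure (t '' Set.Iio p) := by
    rw [← Subgroup.closure_toSubmonoid_of_finite, hgen]
    trivial
  induction hg using Submonoid.closure_induction with
  | mem x hx =>
    obtain ⟨d, hd, rfl⟩ := hx
    exact ⟨[d], by simpa using hd, by simp⟩
  | one => exact ⟨[], by simp, by simp⟩
  | mul x y _ _ hx hy =>
    obtain ⟨w, hw, rfl⟩ := hx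
    obtain ⟨v, hv, rfl⟩ := hy
    refine ⟨w ++ v, ?_, by simp⟩
    intro d hd
    rcases List.mem_append.1 hd with h | h
    · exact hw d h
    · exact hv d h

theorem aux_surj {p : ℕ} (hp : 2 ≤ p) {G : Type*} [Group G] [Finite G]
    (t : ℕ → G) (hgen : Subgroup.closure (t '' Set.Iio p) = ⊤) (g : G) :
    ∃ k : ℕ, ((Nat.digits p (k + 1)).map t).prod = g := by
  have key : ∀ w : List ℕ, (∀ d ∈ w, d < p) →
      ∃ k : ℕ, ((Nat.digits p (k + 1)).map t).prod = (w.map t).prod * t 1 := by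
    intro w
    induction w with
    | nil =>
      intro _
      refine ⟨0, ?_⟩
      rw [Nat.digits_of_lt p (0 + 1) (by omega) (by omega)]
      simp
    | cons d w ih =>
      intro hw
      obtain ⟨k, hk⟩ := ih (fun e he => hw e (List.mem_cons_of_mem _ he))
      refine ⟨p * (k + 1) + d - 1, ?_⟩
      have h0 : 0 < p * (k + 1) := Nat.mul_pos (by omega) (by omega)
      have h2 : p * (k + 1) + d - 1 + 1 = p * (k + 1) + d := by omega
      rw [h2, aux_digits hp _ _ (hw d (by simp)) (by omega)]
      simp [hk, mul_assoc]
  obtain ⟨w, hw, h⟩ := aux_gen t hgen (g * (t 1)⁻¹)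
  obtain ⟨k, hk⟩ := key w hw
  exact ⟨k, by rw [hk, h]; simp⟩

/-- If `a` is the `G/K`-valued sequence produced by the Cayley-graph automaton of a finite
group `G` with generators `t 0, …, t (p-1)`, initial state `1` and labeling the natural map
`G → G/K`, then `a` is `p`-automatic and self-similar, the maps `t_i` are bijections of `N(a)`
and the group `G(a)` they generate (described through words in the `t_i`) acts freely on `N(a)`
(so `Γ(a)` is the Cayley graph of `G(a)`); if moreover the intersection of all conjugates of
`K` is trivial, then `G` can be identified with `G(a)` and `Γ(a)` with the graph underlying the
automaton, via a bijection `β : G → N(a)` and the induced isomorphism `Φ` (with the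
composition convention `u^{g h} = (u^g)^h`) carrying each generator `t i` to the map `t_i`. -/
theorem stmt_12 {p : ℕ} (hp : 2 ≤ p) {G : Type*} [Group G] [Finite G]
    (t : ℕ → G) (hgen : Subgroup.closure (t '' Set.Iio p) = ⊤)
    (K : Subgroup G) (a : ℕ → G ⧸ K)
    (haeq : ∀ k : ℕ,
      a k = (((Nat.digits p (k + 1)).foldl (fun g d => g * t d) 1 : G) : G ⧸ K)) :
    IsAutomatic p a ∧ SelfSimilar p a ∧
    (∀ i < p, Set.BijOn (fun u => subSeq p u 1 i) (NSet p a) (NSet p a)) ∧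
    (∀ w : List ℕ, (∀ d ∈ w, d < p) →
      (∃ u ∈ NSet p a, w.foldl (fun v d => subSeq p v 1 d) u = u) →
        ∀ v ∈ NSet p a, w.foldl (fun v d => subSeq p v 1 d) v = v) ∧
    ((∀ h : G, (∀ g : G, g⁻¹ * h * g ∈ K) → h = 1) →
      ∃ β : G → (ℕ → G ⧸ K),
        β 1 = a ∧ Set.range β = NSet p a ∧ Function.Injective β ∧
        (∀ g : G, ∀ i < p, β (g * t i) = subSeq p (β g) 1 i) ∧
        ∃ Φ : G → ((ℕ → G ⧸ K) → (ℕ → G ⧸ K)),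
          (∀ g x : G, Φ g (β x) = β (x * g)) ∧
          (∀ g₁ g₂ : G, (∀ u ∈ NSet p a, Φ g₁ u = Φ g₂ u) → g₁ = g₂) ∧
          (∀ g h : G, ∀ u ∈ NSet p a, Φ (g * h) u = Φ h (Φ g u)) ∧
          (∀ i < p, ∀ u ∈ NSet p a, Φ (t i) u = subSeq p u 1 i) ∧
          (∀ g : G, ∃ w : List ℕ, (∀ d ∈ w, d < p) ∧
            ∀ u ∈ NSet p a, Φ g u = w.foldl (fun v d => subSeq p v 1 d) u) ∧
          (∀ w : List ℕ, (∀ d ∈ w, d < p) →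
            ∃ g : G, ∀ u ∈ NSet p a, Φ g u = w.foldl (fun v d => subSeq p v 1 d) u)) := by
  obtain ⟨β, hβ⟩ : ∃ β : G → (ℕ → G ⧸ K), ∀ g k,
      β g k = ((g * ((Nat.digits p (k + 1)).map t).prod : G) : G ⧸ K) := ⟨_, fun _ _ => rfl⟩
  have hβ1 : β 1 = a := by
    funext k
    rw [hβ, haeq, aux_foldl]
  have hiff : ∀ g g' : G, β g = β g' ↔ ∀ x : G, ((g * x : G) : G ⧸ K) = ((g' * x : G) : G ⧸ K) := by
    intro g g'
    constructor
    · intro h x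
      obtain ⟨k, rfl⟩ := aux_surj hp t hgen x
      rw [← hβ, ← hβ, h]
    · intro h
      funext k
      rw [hβ, hβ, h]
  have hsub : ∀ g : G, ∀ i < p, β (g * t i) = subSeq p (β g) 1 i := by
    intro g i hi
    funext k
    have h0 : 0 < p * (k + 1) := Nat.mul_pos (by omega) (by omega)
    have h2 : p ^ 1 * (k + 1) + i - 1 + 1 = p * (k + 1) + i := by rw [pow_one]; omega
    simp only [subSeq]
    rw [hβ, hβ, h2, aux_digits hp _ _ hi (by omega)]
    simp [mul_assoc]
  have hfold : ∀ w : List ℕ, (∀ d ∈ w, d < p) → ∀ g,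
      w.foldl (fun v d => subSeq p v 1 d) (β g) = β (g * (w.map t).prod) := by
    intro w
    induction w with
    | nil => intro _ g; simp
    | cons d w ih =>
      intro hw g
      rw [List.foldl_cons, ← hsub g d (hw d (by simp)),
        ih (fun e he => hw e (List.mem_cons_of_mem _ he))]
      simp [mul_assoc]
  have hrange : Set.range β = NSet p a := by
    ext u
    constructor
    · rintro ⟨g, rfl⟩
      obtain ⟨w, hw, rfl⟩ := aux_gen t hgen g
      obtain ⟨i, j, hj, h⟩ := aux_word (Δ := G ⧸ K) hp w hw
      refine ⟨i, j, hj, ?_⟩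
      rw [← h, ← hβ1, hfold w hw, one_mul]
    · rintro ⟨i, j, hj, rfl⟩
      obtain ⟨w, hw, h⟩ := aux_word' (Δ := G ⧸ K) hp i j hj
      rw [← h, ← hβ1, hfold w hw]
      exact ⟨_, rfl⟩
  have hmul : ∀ c g g' : G, β g = β g' → β (c * g) = β (c * g') := by
    intro c g g' h
    funext k
    have := congrArg (fun q : G ⧸ K => c • q) (congrFun h k)
    simpa [hβ, mul_assoc] using this
  have hmulr : ∀ c g g' : G, β g = β g' → β (g * c) = β (g' * c) := by
    intro c g g' h
    rw [hiff] at h ⊢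
    intro x
    simpa [mul_assoc] using h (c * x)
  rw [IsAutomatic, SelfSimilar, ← hrange]
  refine ⟨Set.finite_range β, ?_, ?_, ?_, ?_⟩
  · rintro _ ⟨g, rfl⟩
    refine ⟨MulAction.toPerm g, fun k => ?_⟩
    rw [← hβ1, hβ, hβ]
    simp
  · intro i hi
    refine ⟨?_, ?_, ?_⟩
    · rintro _ ⟨g, rfl⟩
      exact ⟨g * t i, hsub g i hi⟩
    · rintro _ ⟨g, rfl⟩ _ ⟨h, rfl⟩ hgh
      simp only [← hsub _ i hi] at hgh
      simpa using hmulr (t i)⁻¹ _ _ hgh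
    · rintro _ ⟨g, rfl⟩
      refine ⟨β (g * (t i)⁻¹), ⟨_, rfl⟩, ?_⟩
      simp only [← hsub _ i hi]
      simp
  · rintro w hw ⟨_, ⟨g, rfl⟩, hg⟩ _ ⟨h, rfl⟩
    rw [hfold w hw] at hg ⊢
    simpa [mul_assoc] using hmul (h * g⁻¹) _ _ hg
  · intro hK
    have hinj : Function.Injective β := by
      intro g g' h
      rw [hiff] at h
      have : g⁻¹ * g' = 1 := by
        apply hK
        intro x
        have := QuotientGroup.eq.1 (h x)
        simpa [mul_assoc] using this
      exact inv_mul_eq_one.1 this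
    have hΦ : ∀ g x : G, (fun g u => β (Function.invFun β u * g)) g (β x) = β (x * g) := by
      intro g x
      simp only [Function.leftInverse_invFun hinj x]
    refine ⟨β, hβ1, rfl, hinj, hsub, fun g u => β (Function.invFun β u * g), hΦ, ?_, ?_, ?_, ?_, ?_⟩
    · intro g₁ g₂ h
      have := h (β 1) ⟨1, rfl⟩
      rw [hΦ, hΦ] at this
      simpa using hinj this
    · rintro g h _ ⟨x, rfl⟩
      simp only [Function.leftInverse_invFun hinj _, mul_assoc]
    · rintro i hi _ ⟨x, rfl⟩
      rw [hΦ, hsub x i hi]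
    · intro g
      obtain ⟨w, hw, rfl⟩ := aux_gen t hgen g
      refine ⟨w, hw, ?_⟩
      rintro _ ⟨x, rfl⟩
      rw [hΦ, hfold w hw]
    · intro w hw
      refine ⟨(w.map t).prod, ?_⟩
      rintro _ ⟨x, rfl⟩
      rw [hΦ, hfold w hw]
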